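/- There exists a Lie bracket μ on ℝ^8 such that (ℝ^8, μ) is isomorphic to sl(3,ℝ) and (ℝ^8, μ) contracts onto g_{−1}. -/

import Mathlib

/-- The underlying space `ℝ⁸` of the family `g_α`. -/
abbrev V8 : Type := Fin 8 → ℝ

/-- The standard basis vector `X_{k+1}` (0-indexed: `e8 k`). -/
def e8 (k : Fin 8) : V8 := fun l => if l = k then 1 else 0

/-- Brackets of basis elements of `g_α` for `i < j` (0-indexed, `X_{i+1} = e8 i`):
`u α i j = [X_{i+1}, X_{j+1}]`. -/
noncomputable def gUpper (α : ℝ) : Fin 8 → Fin 8 → V8 := fun i j =>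
  match (i : ℕ), (j : ℕ) with
  | 0, 1 => (2 : ℝ) • e8 1          -- [X₁,X₂] = 2X₂
  | 0, 2 => (-2 : ℝ) • e8 2         -- [X₁,X₃] = −2X₃
  | 1, 2 => e8 0                    -- [X₂,X₃] = X₁
  | 0, 3 => e8 3                    -- [X₁,X₄] = X₄
  | 0, 4 => -e8 4                   -- [X₁,X₅] = −X₅
  | 0, 5 => e8 5                    -- [X₁,X₆] = X₆
  | 0, 6 => -e8 6                   -- [X₁,X₇] = −X₇
  | 1, 4 => e8 3                    -- [X₂,X₅] = X₄
  | 1, 6 => e8 5                    -- [X₂,X₇] = X₆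
  | 2, 3 => e8 4                    -- [X₃,X₄] = X₅
  | 2, 5 => e8 6                    -- [X₃,X₆] = X₇
  | 3, 7 => e8 3                    -- [X₄,X₈] = X₄
  | 4, 7 => e8 4                    -- [X₅,X₈] = X₅
  | 5, 7 => α • e8 5                -- [X₆,X₈] = αX₆
  | 6, 7 => α • e8 6                -- [X₇,X₈] = αX₇
  | _, _ => 0

/-- The structure constants `C_{ij}^k` of `g_α`. -/
noncomputable def gC (α : ℝ) (i j k : Fin 8) : ℝ := gUpper α i j k - gUpper α j i k

/-- The bilinear map on `ℝ⁸` with structure constants `C`. -/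
noncomputable def brOf (C : Fin 8 → Fin 8 → Fin 8 → ℝ) : V8 →ₗ[ℝ] V8 →ₗ[ℝ] V8 :=
  LinearMap.mk₂ ℝ (fun x y k => ∑ i, ∑ j, C i j k * x i * y j)
    (by
      intro x x' y
      funext k
      simp only [Pi.add_apply]
      rw [← Finset.sum_add_distrib]
      refine Finset.sum_congr rfl fun i _ => ?_
      rw [← Finset.sum_add_distrib]
      exact Finset.sum_congr rfl fun j _ => by ring)
    (by
      intro c x y
      funext k
      simp only [Pi.smul_apply, smul_eq_mul]
      rw [Finset.mul_sum]
      refine Finset.sum_congr rfl fun i _ => ?_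
      rw [Finset.mul_sum]
      exact Finset.sum_congr rfl fun j _ => by ring)
    (by
      intro x y y'
      funext k
      simp only [Pi.add_apply]
      rw [← Finset.sum_add_distrib]
      refine Finset.sum_congr rfl fun i _ => ?_
      rw [← Finset.sum_add_distrib]
      exact Finset.sum_congr rfl fun j _ => by ring)
    (by
      intro c x y
      funext k
      simp only [Pi.smul_apply, smul_eq_mul]
      rw [Finset.mul_sum]
      refine Finset.sum_congr rfl fun i _ => ?_
      rw [Finset.mul_sum]
      exact Finset.sum_congr rfl fun j _ => by ring)

/-- The Lie bracket `μ_α` of the Lie algebra `g_α`, as a bilinear map on `ℝ⁸`. -/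
noncomputable def brA (α : ℝ) : V8 →ₗ[ℝ] V8 →ₗ[ℝ] V8 := brOf (gC α)

open Filter Topology in
/-- `(ℝ⁸, B)` contracts onto `(ℝ⁸, B')`. -/
def ContractsBil (B B' : V8 →ₗ[ℝ] V8 →ₗ[ℝ] V8) : Prop :=
  ∃ Φ : ℝ → (V8 ≃ₗ[ℝ] V8), ∀ X Y : V8,
    Tendsto (fun t : ℝ => (Φ t).symm (B (Φ t X) (Φ t Y))) atTop (𝓝 (B' X Y))

/-- A bilinear map satisfies the Jacobi identity. -/
def JacobiBil (B : V8 →ₗ[ℝ] V8 →ₗ[ℝ] V8) : Prop :=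
  ∀ x y z : V8, B x (B y z) + B y (B z x) + B z (B x y) = 0

open Filter Topology

/-- The traceless `3 × 3` matrix with coordinates `x` in a basis of `sl(3, ℝ)` adapted to the
subalgebra `gl(2, ℝ)`. -/
noncomputable def slMatrix (x : V8) : Matrix (Fin 3) (Fin 3) ℝ :=
  !![x 0 - x 7 / 3, x 1, x 3; x 2, -x 0 - x 7 / 3, x 4; -x 6, x 5, 2 * x 7 / 3]

/-- The coordinates of a traceless matrix in the basis underlying `slMatrix`. -/
noncomputable def slCoords (m : Matrix (Fin 3) (Fin 3) ℝ) : V8 :=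
  ![(m 0 0 - m 1 1) / 2, m 0 1, m 1 0, m 0 2, m 1 2, m 2 1, -m 2 0, 3 / 2 * m 2 2]

theorem trace_slMatrix (x : V8) : (slMatrix x).trace = 0 := by
  simp [slMatrix, Matrix.trace_fin_three]
  ring

theorem slCoords_slMatrix (x : V8) : slCoords (slMatrix x) = x := by
  funext k
  fin_cases k <;> simp [slCoords, slMatrix]

theorem slMatrix_slCoords {m : Matrix (Fin 3) (Fin 3) ℝ} (hm : m.trace = 0) :
    slMatrix (slCoords m) = m := by
  rw [Matrix.trace_fin_three] at hm
  ext i j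
  fin_cases i <;> fin_cases j <;> simp [slCoords, slMatrix] <;> linarith

/-- The coordinate isomorphism `ℝ⁸ ≃ sl(3, ℝ)`. -/
noncomputable def slEquiv : V8 ≃ₗ[ℝ] ↥(LieAlgebra.SpecialLinear.sl (Fin 3) ℝ) where
  toFun x := ⟨slMatrix x, LinearMap.mem_ker.2 (trace_slMatrix x)⟩
  map_add' x y := by
    ext i j
    fin_cases i <;> fin_cases j <;> simp [slMatrix] <;> ring
  map_smul' c x := by
    ext i j
    fin_cases i <;> fin_cases j <;> simp [slMatrix] <;> ring
  invFun m := slCoords m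
  left_inv x := slCoords_slMatrix x
  right_inv m := Subtype.ext
    (slMatrix_slCoords (LinearMap.mem_ker.1 m.2))

/-- The bracket of `sl(3, ℝ)` transported to `ℝ⁸` along `slEquiv`. -/
noncomputable def slBracket : V8 →ₗ[ℝ] V8 →ₗ[ℝ] V8 :=
  LinearMap.mk₂ ℝ (fun x y => slEquiv.symm ⁅slEquiv x, slEquiv y⁆)
    (by simp) (by simp) (by simp) (by simp)

theorem slBracket_apply (x y : V8) :
    slBracket x y = slEquiv.symm ⁅slEquiv x, slEquiv y⁆ := rfl

theorem slEquiv_slBracket (x y : V8) : slEquiv (slBracket x y) = ⁅slEquiv x, slEquiv y⁆ := by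
  simp [slBracket_apply]

theorem slBracket_eq_slCoords (x y : V8) :
    slBracket x y = slCoords (slMatrix x * slMatrix y - slMatrix y * slMatrix x) := rfl

theorem slBracket_jacobi : JacobiBil slBracket := fun x y z =>
  slEquiv.injective (by simp only [map_add, slEquiv_slBracket, map_zero, lie_jacobi])

theorem slBracket_eq (x y : V8) : slBracket x y =
    ![x 1 * y 2 - x 2 * y 1 + (-x 3 * y 6 + x 6 * y 3 - x 4 * y 5 + x 5 * y 4) / 2,
      2 * (x 0 * y 1 - x 1 * y 0) + (x 3 * y 5 - x 5 * y 3),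
      -2 * (x 0 * y 2 - x 2 * y 0) + (-x 4 * y 6 + x 6 * y 4),
      x 0 * y 3 - x 3 * y 0 + (x 1 * y 4 - x 4 * y 1) + (x 3 * y 7 - x 7 * y 3),
      -(x 0 * y 4 - x 4 * y 0) + (x 2 * y 3 - x 3 * y 2) + (x 4 * y 7 - x 7 * y 4),
      x 0 * y 5 - x 5 * y 0 + (x 1 * y 6 - x 6 * y 1) - (x 5 * y 7 - x 7 * y 5),
      -(x 0 * y 6 - x 6 * y 0) + (x 2 * y 5 - x 5 * y 2) - (x 6 * y 7 - x 7 * y 6),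
      3 / 2 * (-x 6 * y 3 + x 3 * y 6 + x 5 * y 4 - x 4 * y 5)] := by
  rw [slBracket_eq_slCoords]
  funext k
  fin_cases k <;> simp [slCoords, slMatrix] <;> ring

set_option maxHeartbeats 2000000 in
theorem brA_apply (α : ℝ) (x y : V8) : brA α x y =
    ![x 1 * y 2 - x 2 * y 1,
      2 * (x 0 * y 1 - x 1 * y 0),
      -2 * (x 0 * y 2 - x 2 * y 0),
      x 0 * y 3 - x 3 * y 0 + (x 1 * y 4 - x 4 * y 1) + (x 3 * y 7 - x 7 * y 3),
      -(x 0 * y 4 - x 4 * y 0) + (x 2 * y 3 - x 3 * y 2) + (x 4 * y 7 - x 7 * y 4),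
      x 0 * y 5 - x 5 * y 0 + (x 1 * y 6 - x 6 * y 1) + α * (x 5 * y 7 - x 7 * y 5),
      -(x 0 * y 6 - x 6 * y 0) + (x 2 * y 5 - x 5 * y 2) + α * (x 6 * y 7 - x 7 * y 6),
      0] := by
  funext k
  fin_cases k <;>
    simp [brA, brOf, gC, gUpper, e8, Fin.sum_univ_eight] <;> ring

/-- The diagonal automorphism of `ℝ⁸` scaling the span of `X₄, …, X₇` by `s`. -/
noncomputable def radicalScaling (s : ℝˣ) : V8 ≃ₗ[ℝ] V8 :=
  LinearEquiv.piCongrRight fun k =>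
    LinearEquiv.smulOfUnit ((![1, 1, 1, s, s, s, s, 1] : Fin 8 → ℝˣ) k)

theorem radicalScaling_apply (s : ℝˣ) (x : V8) : radicalScaling s x =
    ![x 0, x 1, x 2, s * x 3, s * x 4, s * x 5, s * x 6, x 7] := by
  funext k
  fin_cases k <;> simp [radicalScaling, LinearEquiv.smulOfUnit, Units.smul_def]

/-- Rescaling the bracket of `sl(3, ℝ)` perturbs that of `g_{-1}` by a term of order `s ^ 2`. -/
theorem radicalScaling_symm_slBracket (s : ℝˣ) (x y : V8) :
    (radicalScaling s).symm (slBracket (radicalScaling s x) (radicalScaling s y)) =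
      brA (-1) x y + (s : ℝ) ^ 2 • (slBracket x y - brA (-1) x y) := by
  rw [LinearEquiv.symm_apply_eq]
  simp only [radicalScaling_apply, slBracket_eq, brA_apply]
  funext k
  fin_cases k <;> simp <;> ring

theorem slBracket_contracts : ContractsBil slBracket (brA (-1)) := by
  refine ⟨fun t => radicalScaling (Units.mk0 (Real.exp (-t)) (Real.exp_ne_zero _)),
    fun x y => ?_⟩
  simp only [radicalScaling_symm_slBracket, Units.val_mk0]
  have h : Tendsto (fun t : ℝ => Real.exp (-t) ^ 2) atTop (𝓝 0) := by
    simpa using Real.tendsto_exp_neg_atTop_nhds_zero.pow 2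
  simpa using (h.smul_const (slBracket x y - brA (-1) x y)).const_add (brA (-1) x y)

/-- There is a Lie bracket `μ` on `ℝ⁸` such that `(ℝ⁸,μ)` is isomorphic to `sl(3,ℝ)`
and `(ℝ⁸,μ)` contracts onto `g_{−1}`. -/
theorem sl3_contracts_onto_g_minus_one :
    ∃ B : V8 →ₗ[ℝ] V8 →ₗ[ℝ] V8, (∀ x : V8, B x x = 0) ∧ JacobiBil B ∧
      (∃ e : V8 ≃ₗ[ℝ] ↥(LieAlgebra.SpecialLinear.sl (Fin 3) ℝ),
        ∀ x y : V8, e (B x y) = ⁅e x, e y⁆) ∧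
      ContractsBil B (brA (-1)) :=
  ⟨slBracket, fun x => by simp [slBracket_apply], slBracket_jacobi,
    ⟨slEquiv, slEquiv_slBracket⟩, slBracket_contracts⟩
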